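/- arXiv:2507.09434 — 2 statements merged into one kernel-verified Lean document; each statement's English description precedes it below -/
import Mathlib

section
/- For real A, B, C > 0, the infimum in the definition of F(A,B,C) := inf over (A,B,C)-compositions of Σ_{i≠j} a_i b_j is attained by a composition of length ℓ = ⌈(A+B)/C⌉ satisfying: a_i + b_i = C for all i < ℓ, and a_i − b_i is constant for all i < ℓ; moreover if that constant differs from a_ℓ − b_ℓ then min(a_ℓ, b_ℓ) = 0 and a_ℓ − b_ℓ lies between 0 and a_1 − b_1; and there is exactly one minimizer with these properties. -/
/-- `F(A,B,C)`: the infimum, over pairs of finite sequences of nonnegative reals with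
`Σaᵢ = A`, `Σbᵢ = B` and `aᵢ + bᵢ ≤ C`, of `Σ_{i≠j} aᵢ bⱼ`. -/
noncomputable def Fcomp (A B C : ℝ) : ℝ :=
  sInf {t : ℝ | ∃ (ℓ : ℕ) (a b : Fin ℓ → ℝ),
    (∀ i, 0 ≤ a i) ∧ (∀ i, 0 ≤ b i) ∧ (∑ i, a i) = A ∧ (∑ i, b i) = B ∧
    (∀ i, a i + b i ≤ C) ∧
    t = ∑ i, ∑ j ∈ Finset.univ \ {i}, a i * b j}

lemma sq_max_sub_superadditive {t s r : ℝ} (ht : 0 ≤ t) (hs : 0 ≤ s) (hsr : s ≤ r) :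
    max (s - t) 0 ^ 2 + max (r - s - t) 0 ^ 2 ≤ max (r - t) 0 ^ 2 := by
  rcases max_cases (s - t) 0 with ⟨h₁, _⟩ | ⟨h₁, _⟩ <;>
  rcases max_cases (r - s - t) 0 with ⟨h₂, _⟩ | ⟨h₂, _⟩ <;>
  rcases max_cases (r - t) 0 with ⟨h₃, _⟩ | ⟨h₃, _⟩ <;> rw [h₁, h₂, h₃] <;> nlinarith

lemma sq_max_sub_exchange {t s r C : ℝ} (hrs : r ≤ s) (hsC : s ≤ C) :
    max (s - t) 0 ^ 2 + max (C + r - s - t) 0 ^ 2 ≤ max (C - t) 0 ^ 2 + max (r - t) 0 ^ 2 := by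
  rcases max_cases (s - t) 0 with ⟨h₁, _⟩ | ⟨h₁, _⟩ <;>
  rcases max_cases (C + r - s - t) 0 with ⟨h₂, _⟩ | ⟨h₂, _⟩ <;>
  rcases max_cases (C - t) 0 with ⟨h₃, _⟩ | ⟨h₃, _⟩ <;>
  rcases max_cases (r - t) 0 with ⟨h₄, _⟩ | ⟨h₄, _⟩ <;> rw [h₁, h₂, h₃, h₄] <;> nlinarith

/-- Among finite families in `[0, C]` with sum `n * C + r`, the sum of the convex function
`s ↦ max (s - t) 0 ^ 2` is largest for `n` copies of `C` and one `r`. -/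
lemma sum_sq_max_sub_le {ι : Type*} {t C : ℝ} (ht : 0 ≤ t) (s : ι → ℝ) (I : Finset ι)
    (h₀ : ∀ i, 0 ≤ s i) (hC : ∀ i, s i ≤ C) (n : ℕ) (r : ℝ) (hr : 0 ≤ r) (hrC : r ≤ C)
    (hsum : ∑ i ∈ I, s i = n * C + r) :
    ∑ i ∈ I, max (s i - t) 0 ^ 2 ≤ n * max (C - t) 0 ^ 2 + max (r - t) 0 ^ 2 := by
  classical
  induction I using Finset.induction_on generalizing n r with
  | empty => simp only [Finset.sum_empty]; positivity
  | insert i I hi ih =>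
    rw [Finset.sum_insert hi] at hsum ⊢
    rcases le_total (s i) r with h | h
    · have := ih n (r - s i) (by linarith) (by linarith [h₀ i]) (by linarith)
      linarith [sq_max_sub_superadditive ht (h₀ i) h]
    · cases n with
      | zero =>
        have hI : 0 ≤ ∑ j ∈ I, s j := Finset.sum_nonneg fun j _ => h₀ j
        simp only [Nat.cast_zero, zero_mul, zero_add] at hsum ⊢
        have hs : s i = r := by linarith
        have := ih 0 0 le_rfl (hr.trans hrC) (by push_cast; linarith)
        rw [hs]
        rw [max_eq_right (show (0 : ℝ) - t ≤ 0 by linarith)] at this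
        push_cast at this
        linarith
      | succ n =>
        push_cast at hsum ⊢
        have := ih n (C + r - s i) (by linarith [hC i]) (by linarith) (by linarith)
        linarith [sq_max_sub_exchange (t := t) h (hC i)]

lemma four_mul_mul_le {a b t : ℝ} (hb : 0 ≤ b) :
    4 * (a * b) ≤ 4 * t * b + max (a + b - t) 0 ^ 2 := by
  rcases max_cases (a + b - t) 0 with ⟨h, _⟩ | ⟨h, _⟩ <;> rw [h]
  · nlinarith [sq_nonneg (a - b - t)]
  · nlinarith

/-- The Lagrangian upper bound for `∑ i, a i * b i` with multiplier `t`. -/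
lemma four_mul_sum_mul_le {ι : Type*} [Fintype ι] {t C r : ℝ} (ht : 0 ≤ t) (htC : t ≤ C)
    (n : ℕ) (hr : 0 ≤ r) (hrC : r ≤ C) (a b : ι → ℝ) (ha : ∀ i, 0 ≤ a i) (hb : ∀ i, 0 ≤ b i)
    (hab : ∀ i, a i + b i ≤ C) (hsum : ∑ i, a i + ∑ i, b i = n * C + r) :
    4 * ∑ i, a i * b i ≤ 4 * t * ∑ i, b i + n * (C - t) ^ 2 + max (r - t) 0 ^ 2 := by
  have h₁ := sum_sq_max_sub_le ht (fun i => a i + b i) Finset.univ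
    (fun i => add_nonneg (ha i) (hb i)) hab n r hr hrC (by rw [Finset.sum_add_distrib, hsum])
  have h₂ : ∑ i, 4 * (a i * b i) ≤ ∑ i, (4 * t * b i + max (a i + b i - t) 0 ^ 2) :=
    Finset.sum_le_sum fun i _ => four_mul_mul_le (hb i)
  rw [Finset.sum_add_distrib, ← Finset.mul_sum, ← Finset.mul_sum] at h₂
  rw [max_eq_left (sub_nonneg.2 htC)] at h₁
  linarith

/-- The optimal differences: `x` for the full parts and `y` for the last part of size `r`. -/
lemma exists_optimal_differences_of_nonneg {C r D : ℝ} (n : ℕ) (hr : 0 < r) (hrC : r ≤ C)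
    (hD : 0 ≤ D) (hDS : D ≤ n * C + r) :
    ∃ x y : ℝ, n * x + y = D ∧ |x| ≤ C ∧ |y| ≤ r ∧ (x ≠ y → |y| = r ∧ y ∈ Set.uIcc 0 x) ∧
      ∀ (ℓ : ℕ) (a b : Fin ℓ → ℝ), (∀ i, 0 ≤ a i) → (∀ i, 0 ≤ b i) → (∀ i, a i + b i ≤ C) →
        ∑ i, a i + ∑ i, b i = n * C + r → ∑ i, a i - ∑ i, b i = D →
        4 * ∑ i, a i * b i ≤ n * (C ^ 2 - x ^ 2) + (r ^ 2 - y ^ 2) := by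
  have hn : (0 : ℝ) ≤ n := Nat.cast_nonneg n
  rcases le_or_gt D ((n + 1) * r) with h | h
  · obtain ⟨x, hx⟩ : ∃ x : ℝ, (n + 1) * x = D := ⟨D / (n + 1), by field_simp⟩
    have hx₀ : 0 ≤ x := by by_contra! hneg; nlinarith
    have hxr : x ≤ r := by by_contra! hlt; nlinarith
    refine ⟨x, x, by linarith, ?_, ?_, fun hne => absurd rfl hne, ?_⟩
    · rw [abs_of_nonneg hx₀]; linarith
    · rwa [abs_of_nonneg hx₀]
    · intro ℓ a b ha hb hab hS hd
      have := four_mul_sum_mul_le hx₀ (hxr.trans hrC) n hr.le hrC a b ha hb hab hS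
      rw [max_eq_left (sub_nonneg.2 hxr)] at this
      have hB : 4 * x * ∑ i, b i = 2 * x * (n * C + r - (n + 1) * x) := by
        rw [hx, ← hS, ← hd]; ring
      rw [hB] at this
      linarith
  · have hn₀ : (0 : ℝ) < n := by
      rcases hn.lt_or_eq with h' | h'
      · exact h'
      · rw [← h'] at h hDS; linarith
    obtain ⟨x, hx⟩ : ∃ x : ℝ, n * x = D - r := ⟨(D - r) / n, by field_simp⟩
    have hrx : r ≤ x := by by_contra! hlt; nlinarith
    have hxC : x ≤ C := by by_contra! hlt; nlinarith
    have hx₀ : 0 ≤ x := hr.le.trans hrx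
    refine ⟨x, r, by linarith, ?_, ?_, fun _ => ⟨abs_of_pos hr, ?_⟩, ?_⟩
    · rwa [abs_of_nonneg hx₀]
    · rw [abs_of_pos hr]
    · rw [Set.uIcc_of_le hx₀]; exact ⟨hr.le, hrx⟩
    · intro ℓ a b ha hb hab hS hd
      have := four_mul_sum_mul_le hx₀ hxC n hr.le hrC a b ha hb hab hS
      rw [max_eq_right (sub_nonpos.2 hrx)] at this
      have hB : 4 * x * ∑ i, b i = 2 * x * (n * C - n * x) := by
        linear_combination 2 * x * (hS - hd + hx)
      rw [hB] at this
      linarith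

lemma exists_optimal_differences {C r D : ℝ} (n : ℕ) (hr : 0 < r) (hrC : r ≤ C)
    (hDS : |D| ≤ n * C + r) :
    ∃ x y : ℝ, n * x + y = D ∧ |x| ≤ C ∧ |y| ≤ r ∧ (x ≠ y → |y| = r ∧ y ∈ Set.uIcc 0 x) ∧
      ∀ (ℓ : ℕ) (a b : Fin ℓ → ℝ), (∀ i, 0 ≤ a i) → (∀ i, 0 ≤ b i) → (∀ i, a i + b i ≤ C) →
        ∑ i, a i + ∑ i, b i = n * C + r → ∑ i, a i - ∑ i, b i = D →
        4 * ∑ i, a i * b i ≤ n * (C ^ 2 - x ^ 2) + (r ^ 2 - y ^ 2) := by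
  rcases le_total 0 D with hD | hD
  · exact exists_optimal_differences_of_nonneg n hr hrC hD ((le_abs_self D).trans hDS)
  · obtain ⟨x, y, hxy, hx, hy, hne, hopt⟩ := exists_optimal_differences_of_nonneg n hr hrC
      (neg_nonneg.2 hD) ((neg_le_abs D).trans hDS)
    refine ⟨-x, -y, by linarith, by rwa [abs_neg], by rwa [abs_neg], fun h => ?_, ?_⟩
    · obtain ⟨h₁, h₂⟩ := hne fun h' => h (by rw [h'])
      refine ⟨by rwa [abs_neg], ?_⟩
      rw [Set.mem_uIcc] at h₂ ⊢
      rcases h₂ with h₂ | h₂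
      · right; constructor <;> linarith
      · left; constructor <;> linarith
    · intro ℓ a b ha hb hab hS hd
      have := hopt ℓ b a hb ha (fun i => by rw [add_comm]; exact hab i)
        (by rw [add_comm, hS]) (by linarith)
      simpa only [neg_sq, mul_comm] using this

lemma eq_or_extreme_of_ne_imp {r x y : ℝ}
    (h : x ≠ y → |y| = r ∧ y ∈ Set.uIcc 0 x) :
    x = y ∨ (y = r ∧ r ≤ x) ∨ (y = -r ∧ x ≤ -r) := by
  by_cases hxy : x = y
  · exact .inl hxy
  · obtain ⟨h₁, h₂⟩ := h hxy
    right
    rw [Set.mem_uIcc] at h₂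
    rcases h₂ with ⟨h₂, h₃⟩ | ⟨h₂, h₃⟩
    · rw [abs_of_nonneg h₂] at h₁
      exact .inl ⟨h₁, by linarith⟩
    · rw [abs_of_nonpos h₃] at h₁
      exact .inr ⟨by linarith, by linarith⟩

lemma last_difference_unique {k r x y x' y' : ℝ} (hk : 0 ≤ k) (hr : 0 ≤ r)
    (hsum : k * x + y = k * x' + y') (hy : |y| ≤ r) (hy' : |y'| ≤ r)
    (h : x ≠ y → |y| = r ∧ y ∈ Set.uIcc 0 x)
    (h' : x' ≠ y' → |y'| = r ∧ y' ∈ Set.uIcc 0 x') : y = y' := by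
  rw [abs_le] at hy hy'
  obtain ⟨_, _⟩ := hy
  obtain ⟨_, _⟩ := hy'
  rcases eq_or_extreme_of_ne_imp h with rfl | ⟨rfl, hx⟩ | ⟨rfl, hx⟩ <;>
  rcases eq_or_extreme_of_ne_imp h' with rfl | ⟨h₁, hx'⟩ | ⟨h₁, hx'⟩ <;>
  apply le_antisymm <;> by_contra! <;> nlinarith

lemma sum_sum_sdiff_singleton_mul {ι : Type*} [Fintype ι] [DecidableEq ι] (a b : ι → ℝ) :
    ∑ i, ∑ j ∈ Finset.univ \ {i}, a i * b j = (∑ i, a i) * (∑ i, b i) - ∑ i, a i * b i := by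
  rw [Finset.sum_mul_sum, ← Finset.sum_sub_distrib]
  refine Finset.sum_congr rfl fun i _ => ?_
  rw [Finset.sum_sdiff_eq_sub (Finset.subset_univ _), Finset.sum_singleton]

lemma min_eq_zero_iff_abs_sub {a b : ℝ} (ha : 0 ≤ a) (hb : 0 ≤ b) :
    min a b = 0 ↔ |a - b| = a + b := by
  rcases le_total a b with h | h
  · rw [min_eq_left h, abs_of_nonpos (by linarith)]
    constructor <;> intro <;> linarith
  · rw [min_eq_right h, abs_of_nonneg (by linarith)]
    constructor <;> intro <;> linarith

lemma last_sum_and_difference {n : ℕ} {a b : Fin (n + 1) → ℝ} {A B C x : ℝ}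
    (hA : ∑ i, a i = A) (hB : ∑ i, b i = B)
    (hC : ∀ i : Fin n, a i.castSucc + b i.castSucc = C)
    (hx : ∀ i : Fin n, a i.castSucc - b i.castSucc = x) :
    a (Fin.last n) + b (Fin.last n) = A + B - n * C ∧
      n * x + (a (Fin.last n) - b (Fin.last n)) = A - B := by
  have h₁ : ∑ i : Fin n, (a i.castSucc + b i.castSucc) = n * C := by simp [hC]
  have h₂ : ∑ i : Fin n, (a i.castSucc - b i.castSucc) = n * x := by simp [hx]
  rw [Finset.sum_add_distrib] at h₁
  rw [Finset.sum_sub_distrib] at h₂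
  rw [Fin.sum_univ_castSucc] at hA hB
  constructor <;> linarith

/-- The infimum defining `F(A,B,C)` is attained by a composition of length
`ℓ = ⌈(A+B)/C⌉` with `aᵢ + bᵢ = C` and `aᵢ − bᵢ` constant for `i < ℓ`; if that constant
differs from `a_ℓ − b_ℓ` then `min(a_ℓ, b_ℓ) = 0` and `a_ℓ − b_ℓ` lies between `0` and
`a₁ − b₁`; and there is exactly one minimizer with these properties. -/
theorem stmt_10 (A B C : ℝ) (hA : 0 < A) (hB : 0 < B) (hC : 0 < C) :
    ∃ (ℓ : ℕ) (_ : ℓ = ⌈(A + B) / C⌉₊) (hpos : 0 < ℓ) (a b : Fin ℓ → ℝ),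
      (∀ i, 0 ≤ a i) ∧ (∀ i, 0 ≤ b i) ∧ (∑ i, a i) = A ∧ (∑ i, b i) = B ∧
      (∀ i, a i + b i ≤ C) ∧
      (∑ i, ∑ j ∈ Finset.univ \ {i}, a i * b j) = Fcomp A B C ∧
      (∀ i : Fin ℓ, (i : ℕ) + 1 < ℓ → a i + b i = C) ∧
      (∀ i j : Fin ℓ, (i : ℕ) + 1 < ℓ → (j : ℕ) + 1 < ℓ → a i - b i = a j - b j) ∧
      (a ⟨0, hpos⟩ - b ⟨0, hpos⟩ ≠ a ⟨ℓ - 1, by omega⟩ - b ⟨ℓ - 1, by omega⟩ →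
        min (a ⟨ℓ - 1, by omega⟩) (b ⟨ℓ - 1, by omega⟩) = 0 ∧
        a ⟨ℓ - 1, by omega⟩ - b ⟨ℓ - 1, by omega⟩ ∈
          Set.uIcc 0 (a ⟨0, hpos⟩ - b ⟨0, hpos⟩)) ∧
      (∀ a' b' : Fin ℓ → ℝ,
        (∀ i, 0 ≤ a' i) → (∀ i, 0 ≤ b' i) → (∑ i, a' i) = A → (∑ i, b' i) = B →
        (∀ i, a' i + b' i ≤ C) →
        (∑ i, ∑ j ∈ Finset.univ \ {i}, a' i * b' j) = Fcomp A B C →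
        (∀ i : Fin ℓ, (i : ℕ) + 1 < ℓ → a' i + b' i = C) →
        (∀ i j : Fin ℓ, (i : ℕ) + 1 < ℓ → (j : ℕ) + 1 < ℓ → a' i - b' i = a' j - b' j) →
        (a' ⟨0, hpos⟩ - b' ⟨0, hpos⟩ ≠ a' ⟨ℓ - 1, by omega⟩ - b' ⟨ℓ - 1, by omega⟩ →
          min (a' ⟨ℓ - 1, by omega⟩) (b' ⟨ℓ - 1, by omega⟩) = 0 ∧
          a' ⟨ℓ - 1, by omega⟩ - b' ⟨ℓ - 1, by omega⟩ ∈
            Set.uIcc 0 (a' ⟨0, hpos⟩ - b' ⟨0, hpos⟩)) →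
        a' = a ∧ b' = b) := by
  obtain ⟨n, hn⟩ : ∃ n, ⌈(A + B) / C⌉₊ = n + 1 :=
    Nat.exists_eq_succ_of_ne_zero (Nat.ceil_pos.2 (by positivity)).ne'
  obtain ⟨hlo, hhi⟩ := (Nat.ceil_eq_iff n.succ_ne_zero).1 hn
  rw [Nat.succ_sub_one, lt_div_iff₀ hC] at hlo
  rw [div_le_iff₀ hC] at hhi
  push_cast at hhi
  obtain ⟨r, hr⟩ : ∃ r, A + B = n * C + r := ⟨A + B - n * C, by ring⟩
  have hr₀ : 0 < r := by linarith
  have hrC : r ≤ C := by linarith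
  obtain ⟨x, y, hxy, hx, hy, hne, hopt⟩ := exists_optimal_differences (D := A - B) n hr₀ hrC
    (by rw [abs_le]; constructor <;> linarith)
  obtain ⟨hx₁, hx₂⟩ := abs_le.1 hx
  obtain ⟨hy₁, hy₂⟩ := abs_le.1 hy
  let a : Fin (n + 1) → ℝ := Fin.snoc (α := fun _ => ℝ) (fun _ => (C + x) / 2) ((r + y) / 2)
  let b : Fin (n + 1) → ℝ := Fin.snoc (α := fun _ => ℝ) (fun _ => (C - x) / 2) ((r - y) / 2)
  have haI (i : Fin n) : a i.castSucc = (C + x) / 2 := by simp [a]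
  have hbI (i : Fin n) : b i.castSucc = (C - x) / 2 := by simp [b]
  have haL : a (Fin.last n) = (r + y) / 2 := by simp [a]
  have hbL : b (Fin.last n) = (r - y) / 2 := by simp [b]
  have ha : ∀ i, 0 ≤ a i := Fin.lastCases (by rw [haL]; linarith) fun i => by rw [haI]; linarith
  have hb : ∀ i, 0 ≤ b i := Fin.lastCases (by rw [hbL]; linarith) fun i => by rw [hbI]; linarith
  have hab : ∀ i, a i + b i ≤ C :=
    Fin.lastCases (by rw [haL, hbL]; linarith) fun i => by rw [haI, hbI]; linarith
  have hsa : ∑ i, a i = A := by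
    simp only [Fin.sum_univ_castSucc, haI, haL, Finset.sum_const, Finset.card_fin, nsmul_eq_mul]
    linarith
  have hsb : ∑ i, b i = B := by
    simp only [Fin.sum_univ_castSucc, hbI, hbL, Finset.sum_const, Finset.card_fin, nsmul_eq_mul]
    linarith
  have hsab : 4 * ∑ i, a i * b i = n * (C ^ 2 - x ^ 2) + (r ^ 2 - y ^ 2) := by
    simp only [Fin.sum_univ_castSucc, haI, haL, hbI, hbL, Finset.sum_const, Finset.card_fin,
      nsmul_eq_mul]
    ring
  have hmin : Fcomp A B C = ∑ i, ∑ j ∈ Finset.univ \ {i}, a i * b j := by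
    refine IsLeast.csInf_eq ⟨⟨n + 1, a, b, ha, hb, hsa, hsb, hab, rfl⟩, ?_⟩
    rintro _ ⟨ℓ, a', b', ha', hb', hsa', hsb', hab', rfl⟩
    have := hopt ℓ a' b' ha' hb' hab' (by rw [hsa', hsb', hr]) (by rw [hsa', hsb'])
    rw [sum_sum_sdiff_singleton_mul, sum_sum_sdiff_singleton_mul, hsa, hsb, hsa', hsb']
    linarith
  have hcast (i : Fin (n + 1)) (hi : (i : ℕ) + 1 < n + 1) : ∃ j : Fin n, i = j.castSucc :=
    ⟨⟨i, by omega⟩, rfl⟩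
  refine ⟨n + 1, hn.symm, n.succ_pos, a, b, ha, hb, hsa, hsb, hab, hmin.symm, ?_, ?_, ?_, ?_⟩
  · intro i hi
    obtain ⟨i, rfl⟩ := hcast i hi
    rw [haI, hbI]; ring
  · intro i j hi hj
    obtain ⟨i, rfl⟩ := hcast i hi
    obtain ⟨j, rfl⟩ := hcast j hj
    rw [haI, hbI, haI, hbI]
  · change a 0 - b 0 ≠ a (Fin.last n) - b (Fin.last n) →
      min (a (Fin.last n)) (b (Fin.last n)) = 0 ∧
        a (Fin.last n) - b (Fin.last n) ∈ Set.uIcc 0 (a 0 - b 0)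
    intro h
    rw [min_eq_zero_iff_abs_sub (ha _) (hb _)]
    have hdL : a (Fin.last n) - b (Fin.last n) = y := by rw [haL, hbL]; ring
    have hsL : a (Fin.last n) + b (Fin.last n) = r := by rw [haL, hbL]; ring
    have hd₀ : a 0 - b 0 = x := by
      rcases eq_or_ne (0 : Fin (n + 1)) (Fin.last n) with h₀ | h₀
      · exact absurd (by rw [h₀]) h
      · obtain ⟨j, hj⟩ := Fin.exists_castSucc_eq.2 h₀
        rw [← hj, haI, hbI]; ring
    rw [hdL, hsL, hd₀]
    rw [hdL, hd₀] at h
    exact hne h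
  · intro a' b' ha' hb' hsa' hsb' _ _ hC' hd' hne'
    change a' 0 - b' 0 ≠ a' (Fin.last n) - b' (Fin.last n) →
      min (a' (Fin.last n)) (b' (Fin.last n)) = 0 ∧
        a' (Fin.last n) - b' (Fin.last n) ∈ Set.uIcc 0 (a' 0 - b' 0) at hne'
    have hCI (i : Fin n) : a' i.castSucc + b' i.castSucc = C := hC' _ (by simp)
    have hdI (i : Fin n) : a' i.castSucc - b' i.castSucc = a' 0 - b' 0 :=
      hd' _ _ (by simp) (by have := i.2; simp; omega)
    obtain ⟨hsL, hdL⟩ := last_sum_and_difference hsa' hsb' hCI hdI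
    have hsL' : a' (Fin.last n) + b' (Fin.last n) = r := by linarith
    rw [min_eq_zero_iff_abs_sub (ha' _) (hb' _), hsL'] at hne'
    have hyL : y = a' (Fin.last n) - b' (Fin.last n) := by
      refine last_difference_unique n.cast_nonneg hr₀.le (hxy.trans hdL.symm) hy ?_ hne hne'
      rw [abs_le]
      constructor <;> linarith [ha' (Fin.last n), hb' (Fin.last n)]
    have hx' (i : Fin n) : a' i.castSucc - b' i.castSucc = x := by
      have hn₀ : (n : ℝ) ≠ 0 := Nat.cast_ne_zero.2 (Nat.ne_of_gt i.pos)
      rw [hdI]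
      exact mul_left_cancel₀ hn₀ (by linarith)
    constructor
    · funext i
      induction i using Fin.lastCases with
      | last => rw [haL]; linarith
      | cast i => rw [haI]; linarith [hx' i, hCI i]
    · funext i
      induction i using Fin.lastCases with
      | last => rw [hbL]; linarith
      | cast i => rw [hbI]; linarith [hx' i, hCI i]
end

section
/- Every tripartite coloring of K_13 has at most g_3(13) = 88 monochromatic triangles, given that every tripartite coloring of K_12 has at most g_3(12) = 70 monochromatic triangles. -/
/-- A tripartite edge coloring of `K_n`: symmetric, and each color class is 3-partite. -/
def IsTripartiteColoring (n : ℕ) (χ : Fin n → Fin n → ℕ) : Prop :=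
  (∀ i j, χ i j = χ j i) ∧
  ∀ c : ℕ, ∃ p : Fin n → Fin 3, ∀ i j : Fin n, i ≠ j → χ i j = c → p i ≠ p j

/-- The set of monochromatic triangles of a coloring. -/
def monoTriangles (n : ℕ) (χ : Fin n → Fin n → ℕ) : Set (Finset (Fin n)) :=
  {s | ∃ x y z : Fin n, x ≠ y ∧ x ≠ z ∧ y ≠ z ∧ s = {x, y, z} ∧
    χ x y = χ y z ∧ χ y z = χ x z}

open Finset

open Classical in
/-- The monochromatic triangles of `χ` with all vertices in `S`. -/
noncomputable def monoTrianglesIn {V : Type*} (χ : V → V → ℕ) (S : Finset V) :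
    Finset (Finset V) :=
  {s ∈ S.powersetCard 3 | ∃ c, ∀ x ∈ s, ∀ y ∈ s, x ≠ y → χ x y = c}

/-- The vertices of `S` joined to `v` by an edge of color `c`. -/
def colorNbrs {V : Type*} (χ : V → V → ℕ) (c : ℕ) (v : V) (S : Finset V) : Finset V :=
  {u ∈ S | χ v u = c}

/-- The edges of color `c` inside the `c`-neighborhood of `v` in `S`. -/
def colorLink {V : Type*} [DecidableEq V] (χ : V → V → ℕ) (c : ℕ) (v : V) (S : Finset V) :
    Finset (Finset V) :=
  {e ∈ (colorNbrs χ c v S).powersetCard 2 | ∀ x ∈ e, ∀ y ∈ e, x ≠ y → χ x y = c}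

section

variable {V : Type*} {χ : V → V → ℕ}

theorem sum_card_colorNbrs (χ : V → V → ℕ) (v : V) (S : Finset V) :
    ∑ c ∈ S.image (χ v), #(colorNbrs χ c v S) = #S :=
  (card_eq_sum_card_image (χ v) S).symm

theorem card_monoTrianglesIn_le_one {S : Finset V} (hS : #S ≤ 3) :
    #(monoTrianglesIn χ S) ≤ 1 := by
  classical
  rw [monoTrianglesIn]
  refine (card_filter_le _ _).trans ?_
  rw [card_powersetCard]
  interval_cases #S <;> decide

variable [DecidableEq V]

theorem card_monoTrianglesIn_insert_le (v : V) (S : Finset V) :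
    #(monoTrianglesIn χ (insert v S)) ≤
      #(monoTrianglesIn χ S) + ∑ c ∈ S.image (χ v), #(colorLink χ c v S) := by
  classical
  have hsub : monoTrianglesIn χ (insert v S) ⊆ monoTrianglesIn χ S ∪
      ((S.image (χ v)).biUnion fun c => colorLink χ c v S).image (insert v) := by
    intro s hs
    simp only [monoTrianglesIn, mem_filter, mem_powersetCard] at hs
    obtain ⟨⟨hsS, hs3⟩, c, hc⟩ := hs
    by_cases hvs : v ∈ s
    · refine mem_union_right _ (mem_image.2 ⟨s.erase v, ?_, insert_erase hvs⟩)
      have hcard : #(s.erase v) = 2 := by rw [card_erase_of_mem hvs, hs3]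
      have hsub : s.erase v ⊆ S := fun x hx => by
        have := hsS (mem_of_mem_erase hx)
        exact (mem_insert.1 this).resolve_left (ne_of_mem_erase hx)
      have hcol : ∀ x ∈ s.erase v, χ v x = c := fun x hx =>
        hc v hvs x (mem_of_mem_erase hx) (ne_of_mem_erase hx).symm
      obtain ⟨x, hx⟩ : (s.erase v).Nonempty := card_pos.1 (by omega)
      refine mem_biUnion.2 ⟨c, mem_image.2 ⟨x, hsub hx, hcol x hx⟩, ?_⟩
      simp only [colorLink, colorNbrs, mem_filter, mem_powersetCard]
      exact ⟨⟨fun y hy => mem_filter.2 ⟨hsub hy, hcol y hy⟩, hcard⟩, fun y hy z hz =>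
        hc y (mem_of_mem_erase hy) z (mem_of_mem_erase hz)⟩
    · refine mem_union_left _ (mem_filter.2 ⟨mem_powersetCard.2 ⟨fun x hx => ?_, hs3⟩, c, hc⟩)
      exact (mem_insert.1 (hsS hx)).resolve_left fun h => hvs (h ▸ hx)
  calc _ ≤ _ := card_le_card hsub
    _ ≤ _ := card_union_le _ _
    _ ≤ _ := Nat.add_le_add_left (card_image_le.trans card_biUnion_le) _

theorem card_colorLink_le {c : ℕ} {v : V} {S : Finset V} (hv : v ∉ S)
    (hχ : ∃ p : V → Fin 3, ∀ i j, i ≠ j → χ i j = c → p i ≠ p j) :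
    #(colorLink χ c v S) ≤ #(colorNbrs χ c v S) ^ 2 / 4 := by
  obtain ⟨p, hp⟩ := hχ
  have hN : ∀ u ∈ colorNbrs χ c v S, p u ≠ p v := fun u hu => by
    obtain ⟨hu, huc⟩ := mem_filter.1 hu
    exact (hp v u (fun h => hv (h ▸ hu)) huc).symm
  set N := colorNbrs χ c v S with hNdef
  set P := {u ∈ N | p u = p v + 1} with hP
  set Q := {u ∈ N | ¬ p u = p v + 1} with hQ
  have hPQ : #P + #Q = #N := card_filter_add_card_filter_not _
  have hthree : ∀ a b d : Fin 3, a ≠ d → b ≠ d → a ≠ b →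
      (a = d + 1 ∧ b ≠ d + 1) ∨ (b = d + 1 ∧ a ≠ d + 1) := by decide
  have hsub : colorLink χ c v S ⊆ (P ×ˢ Q).image fun x => {x.1, x.2} := by
    intro e he
    obtain ⟨he, hec⟩ := mem_filter.1 he
    obtain ⟨heN, he2⟩ := mem_powersetCard.1 he
    obtain ⟨x, y, hxy, rfl⟩ := card_eq_two.1 he2
    have hx : x ∈ N := heN (by simp)
    have hy : y ∈ N := heN (by simp)
    have hne := hp x y hxy (hec x (by simp) y (by simp) hxy)
    rcases hthree _ _ _ (hN x hx) (hN y hy) hne with ⟨h1, h2⟩ | ⟨h1, h2⟩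
    · exact mem_image.2 ⟨(x, y), by simp [hP, hQ, hx, hy, h1, h2], rfl⟩
    · exact mem_image.2 ⟨(y, x), by simp [hP, hQ, hx, hy, h1, h2], pair_comm _ _⟩
  have hle : #(colorLink χ c v S) ≤ #P * #Q :=
    (card_le_card hsub).trans (card_image_le.trans (card_product _ _).le)
  rw [Nat.le_div_iff_mul_le (by norm_num), ← hPQ]
  zify at hle ⊢
  nlinarith [sq_nonneg ((#P : ℤ) - #Q)]

theorem two_mul_card_colorLink_le {c : ℕ} {v : V} {S : Finset V} :
    2 * #(colorLink χ c v S) ≤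
      ∑ u ∈ colorNbrs χ c v S, #(colorNbrs χ c u ((colorNbrs χ c v S).erase u)) := by
  have hcard : ∑ e ∈ colorLink χ c v S, #e = 2 * #(colorLink χ c v S) := by
    rw [sum_const_nat (m := 2), mul_comm]
    intro e he
    exact (mem_powersetCard.1 (mem_filter.1 he).1).2
  have hdouble : ∑ e ∈ colorLink χ c v S, #e =
      ∑ u ∈ colorNbrs χ c v S, #{e ∈ colorLink χ c v S | u ∈ e} := by
    have := sum_card_bipartiteAbove_eq_sum_card_bipartiteBelow
      (s := colorNbrs χ c v S) (t := colorLink χ c v S) (fun u e => u ∈ e)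
    simp only [bipartiteAbove, bipartiteBelow] at this
    rw [this]
    refine sum_congr rfl fun e he => ?_
    rw [filter_mem_eq_inter, inter_eq_right.2]
    exact (mem_powersetCard.1 (mem_filter.1 he).1).1
  rw [← hcard, hdouble]
  refine sum_le_sum fun u hu => ?_
  refine (card_le_card (t := (colorNbrs χ c u ((colorNbrs χ c v S).erase u)).image
    fun w => {u, w}) fun e he => ?_).trans card_image_le
  obtain ⟨he, hue⟩ := mem_filter.1 he
  obtain ⟨he, hec⟩ := mem_filter.1 he
  obtain ⟨heN, he2⟩ := mem_powersetCard.1 he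
  obtain ⟨w, hw⟩ : (e.erase u).Nonempty := card_pos.1 (by rw [card_erase_of_mem hue]; omega)
  have hwe := mem_of_mem_erase hw
  have hwu := ne_of_mem_erase hw
  refine mem_image.2 ⟨w, mem_filter.2 ⟨mem_erase.2 ⟨hwu, heN hwe⟩,
    hec u hue w hwe hwu.symm⟩, ?_⟩
  refine eq_of_subset_of_card_le ?_ ?_
  · simp [insert_subset_iff, hue, hwe]
  · rw [he2, card_pair hwu.symm]

theorem mul_sum_card_colorLink_le {v : V} {S : Finset V} (hv : v ∉ S)
    (hχ : ∀ c, ∃ p : V → Fin 3, ∀ i j, i ≠ j → χ i j = c → p i ≠ p j) {a b : ℕ} {C : Finset ℕ}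
    (hab : ∀ c ∈ C, a * (#(colorNbrs χ c v S) ^ 2 / 4) ≤ b * #(colorNbrs χ c v S)) :
    a * ∑ c ∈ C, #(colorLink χ c v S) ≤ b * ∑ c ∈ C, #(colorNbrs χ c v S) := by
  rw [mul_sum, mul_sum]
  exact sum_le_sum fun c hc =>
    (Nat.mul_le_mul_left a (card_colorLink_le hv (hχ c))).trans (hab c hc)

theorem exists_forall_card_colorNbrs_lt (hsymm : ∀ i j, χ i j = χ j i)
    (hχ : ∀ c, ∃ p : V → Fin 3, ∀ i j, i ≠ j → χ i j = c → p i ≠ p j) {S : Finset V}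
    (hS : 4 ≤ #S) :
    ∃ v ∈ S, ∀ c, #(colorNbrs χ c v (S.erase v)) < #(S.erase v) := by
  by_contra! h
  have hmono : ∀ v ∈ S, ∃ c, ∀ u ∈ S, u ≠ v → χ v u = c := fun v hv => by
    obtain ⟨c, hc⟩ := h v hv
    refine ⟨c, fun u hu huv => ?_⟩
    have := eq_of_subset_of_card_le (filter_subset _ _) hc
    exact (mem_filter.1 (this.symm ▸ mem_erase.2 ⟨huv, hu⟩ : u ∈ colorNbrs χ c v _)).2
  obtain ⟨v, hv⟩ : S.Nonempty := card_pos.1 (by omega)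
  obtain ⟨c, hc⟩ := hmono v hv
  have hall : ∀ x ∈ S, ∀ y ∈ S, x ≠ y → χ x y = c := fun x hx y hy hxy => by
    obtain ⟨d, hd⟩ := hmono x hx
    by_cases hxv : x = v
    · exact hxv ▸ hc y hy (hxv ▸ hxy.symm)
    · rw [hd y hy hxy.symm, ← hd v hv (Ne.symm hxv), hsymm, hc x hx hxv]
  obtain ⟨p, hp⟩ := hχ c
  have := card_le_card_of_injOn (t := univ) p (fun _ _ => mem_univ _) (s := S)
    fun x hx y hy hxy => by_contra fun hne => hp x y hne (hall x hx y hy hne) hxy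
  simp at this
  omega

theorem card_monoTrianglesIn_le_two (hsymm : ∀ i j, χ i j = χ j i)
    (hχ : ∀ c, ∃ p : V → Fin 3, ∀ i j, i ≠ j → χ i j = c → p i ≠ p j) {S : Finset V}
    (hS : #S = 4) : #(monoTrianglesIn χ S) ≤ 2 := by
  obtain ⟨v, hv, hlt⟩ := exists_forall_card_colorNbrs_lt hsymm hχ hS.ge
  have hcard : #(S.erase v) = 3 := by rw [card_erase_of_mem hv, hS]
  have h1 := card_monoTrianglesIn_insert_le (χ := χ) v (S.erase v)
  rw [insert_erase hv] at h1
  have h2 := card_monoTrianglesIn_le_one (χ := χ) hcard.le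
  have h3 := mul_sum_card_colorLink_le (notMem_erase v S) hχ (a := 2) (b := 1)
    (C := (S.erase v).image (χ v)) fun c _ => by
      have := hlt c
      rw [hcard] at this
      interval_cases #(colorNbrs χ c v (S.erase v)) <;> decide
  rw [sum_card_colorNbrs, hcard] at h3
  omega

theorem card_monoTrianglesIn_le_four (hsymm : ∀ i j, χ i j = χ j i)
    (hχ : ∀ c, ∃ p : V → Fin 3, ∀ i j, i ≠ j → χ i j = c → p i ≠ p j) {S : Finset V}
    (hS : #S = 5) : #(monoTrianglesIn χ S) ≤ 4 := by
  obtain ⟨v, hv, hlt⟩ := exists_forall_card_colorNbrs_lt hsymm hχ (hS.ge.trans' (by norm_num))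
  have hcard : #(S.erase v) = 4 := by rw [card_erase_of_mem hv, hS]
  have h1 := card_monoTrianglesIn_insert_le (χ := χ) v (S.erase v)
  rw [insert_erase hv] at h1
  have h2 := card_monoTrianglesIn_le_two hsymm hχ hcard
  have h3 := mul_sum_card_colorLink_le (notMem_erase v S) hχ (a := 3) (b := 2)
    (C := (S.erase v).image (χ v)) fun c _ => by
      have := hlt c
      rw [hcard] at this
      interval_cases #(colorNbrs χ c v (S.erase v)) <;> decide
  rw [sum_card_colorNbrs, hcard] at h3
  omega

/-- A vertex in at least `19` monochromatic triangles of a tripartite coloring of `K_13` has a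
color of degree at least `8`. -/
theorem exists_eight_le_card_colorNbrs {v : V} {S : Finset V} (hv : v ∉ S) (hS : #S = 12)
    (hχ : ∀ c, ∃ p : V → Fin 3, ∀ i j, i ≠ j → χ i j = c → p i ≠ p j)
    (ht : 19 ≤ ∑ c ∈ S.image (χ v), #(colorLink χ c v S)) :
    ∃ c ∈ S.image (χ v), 8 ≤ #(colorNbrs χ c v S) := by
  by_contra! h
  have hsum := sum_card_colorNbrs χ v S
  by_cases h7 : ∃ c ∈ S.image (χ v), #(colorNbrs χ c v S) = 7
  · obtain ⟨c, hc, hc7⟩ := h7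
    rw [← add_sum_erase _ _ hc] at hsum ht
    have h1 := card_colorLink_le hv (hχ c)
    rw [hc7] at h1 hsum
    have h3 := mul_sum_card_colorLink_le hv hχ (a := 5) (b := 6)
      (C := (S.image (χ v)).erase c) fun d hd => by
        have := single_le_sum (f := fun d => #(colorNbrs χ d v S)) (fun _ _ => Nat.zero_le _) hd
        have hle : #(colorNbrs χ d v S) ≤ 5 := by omega
        interval_cases #(colorNbrs χ d v S) <;> decide
    omega
  · push Not at h7
    have h3 := mul_sum_card_colorLink_le hv hχ (a := 2) (b := 3)
      (C := S.image (χ v)) fun d hd => by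
        have h8 := h d hd
        have h7 := h7 d hd
        have hle : #(colorNbrs χ d v S) ≤ 6 := by omega
        interval_cases #(colorNbrs χ d v S) <;> decide
    omega

theorem card_colorNbrs_add_le {v : V} {S : Finset V} {c d : ℕ} (hcd : c ≠ d) :
    #(colorNbrs χ c v S) + #(colorNbrs χ d v S) ≤ #S := by
  rw [← card_union_of_disjoint]
  · exact card_le_card (union_subset (filter_subset _ _) (filter_subset _ _))
  · exact disjoint_filter.2 fun x _ h1 h2 => hcd (h1.symm.trans h2)

/-- If `8` or more of the `12` edges at `v` have color `c`, then the other colors contribute at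
most one triangle at `v` for each of their edges at `v`. -/
theorem card_colorNbrs_add_seven_le {v : V} {S : Finset V} {c : ℕ} (hv : v ∉ S) (hS : #S = 12)
    (hχ : ∀ c, ∃ p : V → Fin 3, ∀ i j, i ≠ j → χ i j = c → p i ≠ p j)
    (ht : 19 ≤ ∑ c ∈ S.image (χ v), #(colorLink χ c v S))
    (hc : c ∈ S.image (χ v)) (h8 : 8 ≤ #(colorNbrs χ c v S)) :
    #(colorNbrs χ c v S) + 7 ≤ #(colorLink χ c v S) := by
  have hsum := sum_card_colorNbrs χ v S
  rw [← add_sum_erase _ _ hc] at hsum ht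
  have h3 := mul_sum_card_colorLink_le hv hχ (a := 1) (b := 1)
    (C := (S.image (χ v)).erase c) fun d hd => by
      have := card_colorNbrs_add_le (χ := χ) (v := v) (S := S) (ne_of_mem_erase hd)
      have hle : #(colorNbrs χ d v S) ≤ 4 := by omega
      interval_cases #(colorNbrs χ d v S) <;> decide
  omega

end

/-- If every vertex has degree at least `8` in the color `α`, then the `α`-edges form an almost
complete tripartite graph with parts of sizes `5, 4, 4` or `5, 5, 3`. -/
theorem card_monoTrianglesIn_le_of_forall_eight_le {χ : Fin 13 → Fin 13 → ℕ}
    (hsymm : ∀ i j, χ i j = χ j i)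
    (hχ : ∀ c, ∃ p : Fin 13 → Fin 3, ∀ i j, i ≠ j → χ i j = c → p i ≠ p j) {α : ℕ}
    (hα : ∀ v, 8 ≤ #(colorNbrs χ α v (univ.erase v))) :
    #(monoTrianglesIn χ univ) ≤ 88 := by
  classical
  obtain ⟨p, hp⟩ := hχ α
  let P : Fin 3 → Finset (Fin 13) := fun i => {u | p u = i}
  let X : Fin 13 → Finset (Fin 13) := fun v => {u | p u ≠ p v ∧ χ v u ≠ α}
  have hsum : #(P 0) + #(P 1) + #(P 2) = 13 := by
    have := card_eq_sum_card_fiberwise (f := p) (s := univ) (t := univ)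
      fun _ _ => mem_coe.2 (mem_univ _)
    rw [Fin.sum_univ_three] at this
    simpa [P] using this.symm
  have hX : ∀ v, #(X v) + #(P (p v)) ≤ 5 := fun v => by
    have hcover : #(colorNbrs χ α v (univ.erase v)) + (#(X v) + #(P (p v))) ≤ 13 := by
      rw [← card_union_of_disjoint, ← card_union_of_disjoint]
      · exact card_le_univ _
      · rw [disjoint_left]
        intro u hu hu'
        obtain ⟨hu, huα⟩ := mem_filter.1 hu
        rcases mem_union.1 hu' with h | h
        · exact (mem_filter.1 h).2.2 huα
        · exact hp v u (ne_of_mem_erase hu).symm huα (mem_filter.1 h).2.symm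
      · exact disjoint_filter.2 fun u _ h h' => h.1 h'
    have := hα v
    omega
  have hP5 : ∀ i, #(P i) ≤ 5 := fun i => by
    rcases (P i).eq_empty_or_nonempty with h | ⟨w, hw⟩
    · simp [h]
    · have := hX w
      rw [(mem_filter.1 hw).2] at this
      omega
  have hmatch : ∀ y, ∀ x ∈ X y, ∀ x' ∈ X y, x = x' := fun y x hx x' hx' => by
    by_contra hne
    have h2 : 2 ≤ #(X y) := one_lt_card.2 ⟨x, hx, x', hx', hne⟩
    obtain ⟨-, hxp, hxα⟩ := mem_filter.1 hx
    have h1 : 1 ≤ #(X x) := card_pos.2 ⟨y, by simp [X, hxp.symm, hsymm x y, hxα]⟩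
    have hy := hX y
    have hx := hX x
    have h0 := hP5 0
    have h1 := hP5 1
    have h2 := hP5 2
    generalize p y = i at *
    generalize p x = j at *
    fin_cases i <;> fin_cases j <;> simp at hxp hy hx <;> omega
  have hsub : monoTrianglesIn χ univ ⊆
      ((P 0 ×ˢ P 1 ×ˢ P 2).image fun x => {x.1, x.2.1, x.2.2}) ∪
      (monoTrianglesIn χ (P 0) ∪ monoTrianglesIn χ (P 1) ∪ monoTrianglesIn χ (P 2)) := by
    intro s hs
    obtain ⟨hs, c, hc⟩ := mem_filter.1 hs
    have hs3 := (mem_powersetCard.1 hs).2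
    by_cases hcα : c = α
    · refine mem_union_left _ ?_
      have hinj : Set.InjOn p s := fun x hx y hy hxy =>
        by_contra fun hne => hp x y hne ((hc x hx y hy hne).trans hcα) hxy
      have himg : s.image p = univ := by
        rw [← card_eq_iff_eq_univ, card_image_of_injOn hinj, hs3, Fintype.card_fin]
      have hsurj : ∀ i, ∃ x ∈ s, p x = i := fun i => mem_image.1 (himg ▸ mem_univ i)
      choose x hxs hxp using hsurj
      have hxne : ∀ i j, i ≠ j → x i ≠ x j := fun i j hij h => hij (by rw [← hxp i, h, hxp])
      refine mem_image.2 ⟨(x 0, x 1, x 2), by simp [P, hxp], ?_⟩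
      refine eq_of_subset_of_card_le (by simp [insert_subset_iff, hxs]) ?_
      rw [hs3, card_eq_three.2 ⟨_, _, _, hxne 0 1 (by decide), hxne 0 2 (by decide),
        hxne 1 2 (by decide), rfl⟩]
    · refine mem_union_right _ ?_
      have hsame : ∀ x ∈ s, ∀ y ∈ s, p x = p y := fun x hx y hy => by
        by_contra hxy
        have hne : x ≠ y := fun h => hxy (h ▸ rfl)
        obtain ⟨z, hz, hzx⟩ : ∃ z ∈ s, z ∉ ({x, y} : Finset (Fin 13)) :=
          exists_mem_notMem_of_card_lt_card (by rw [card_pair hne]; omega)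
        simp only [mem_insert, mem_singleton, not_or] at hzx
        have hX' : ∀ u ∈ s, ∀ w ∈ s, u ≠ w → p u ≠ p w → w ∈ X u := fun u hu w hw huw h =>
          mem_filter.2 ⟨mem_univ _, h.symm, by rwa [hc u hu w hw huw]⟩
        by_cases hzp : p z = p x
        · exact hzx.1 (hmatch y z (hX' y hy z hz (Ne.symm hzx.2) (by rw [hzp]; exact Ne.symm hxy))
            x (hX' y hy x hx hne.symm (Ne.symm hxy)))
        · exact hzx.2 (hmatch x z (hX' x hx z hz (Ne.symm hzx.1) (Ne.symm hzp))
            y (hX' x hx y hy hne hxy))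
      obtain ⟨x, hx⟩ : s.Nonempty := card_pos.1 (by omega)
      have hmem : s ∈ monoTrianglesIn χ (P (p x)) := mem_filter.2 ⟨mem_powersetCard.2
        ⟨fun y hy => mem_filter.2 ⟨mem_univ _, hsame y hy x hx⟩, hs3⟩, c, hc⟩
      generalize p x = i at hmem
      fin_cases i
      · exact mem_union_left _ (mem_union_left _ hmem)
      · exact mem_union_left _ (mem_union_right _ hmem)
      · exact mem_union_right _ hmem
  have hcard : #(monoTrianglesIn χ univ) ≤ #(P 0) * (#(P 1) * #(P 2)) +
      (#(monoTrianglesIn χ (P 0)) + #(monoTrianglesIn χ (P 1)) +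
        #(monoTrianglesIn χ (P 2))) := by
    refine (card_le_card hsub).trans ((card_union_le _ _).trans (Nat.add_le_add ?_ ?_))
    · refine card_image_le.trans ?_
      rw [card_product, card_product]
    · exact (card_union_le _ _).trans (Nat.add_le_add_right (card_union_le _ _) _)
  have hpart : ∀ i, #(P i) ≤ 3 ∧ #(monoTrianglesIn χ (P i)) ≤ 1 ∨
      #(P i) = 4 ∧ #(monoTrianglesIn χ (P i)) ≤ 2 ∨
      #(P i) = 5 ∧ #(monoTrianglesIn χ (P i)) ≤ 4 := fun i => by
    rcases (by have := hP5 i; omega : #(P i) ≤ 3 ∨ #(P i) = 4 ∨ #(P i) = 5) with h | h | h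
    · exact .inl ⟨h, card_monoTrianglesIn_le_one h⟩
    · exact .inr (.inl ⟨h, card_monoTrianglesIn_le_two hsymm hχ h⟩)
    · exact .inr (.inr ⟨h, card_monoTrianglesIn_le_four hsymm hχ h⟩)
  have h0 := hpart 0
  have h1 := hpart 1
  have h2 := hpart 2
  have hb0 := hP5 0
  have hb1 := hP5 1
  have hb2 := hP5 2
  generalize #(P 0) = a at *
  generalize #(P 1) = b at *
  obtain rfl | rfl | rfl : a = 3 ∨ a = 4 ∨ a = 5 := by omega
  all_goals obtain rfl | rfl | rfl : b = 3 ∨ b = 4 ∨ b = 5 := by omega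
  all_goals omega

/-- A map to three classes identifies at least a third of all ordered pairs. -/
theorem sq_card_le_three_mul_sum_card {V : Type*} (A : Finset V) (p : V → Fin 3) :
    #A ^ 2 ≤ 3 * ∑ v ∈ A, #{u ∈ A | p u = p v} := by
  have h1 : ∑ v ∈ A, #{u ∈ A | p u = p v} = ∑ i, #{u ∈ A | p u = i} ^ 2 := by
    rw [← sum_fiberwise A p]
    refine sum_congr rfl fun i _ => ?_
    rw [sum_const_nat (m := #{u ∈ A | p u = i}), sq]
    intro v hv
    rw [(mem_filter.1 hv).2]
  have h2 : #A = ∑ i, #{u ∈ A | p u = i} :=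
    card_eq_sum_card_fiberwise fun _ _ => mem_coe.2 (mem_univ _)
  rw [h1, h2]
  simpa using sq_sum_le_card_mul_sum_sq (s := univ) (f := fun i => #{u ∈ A | p u = i})

section

variable {χ : Fin 13 → Fin 13 → ℕ} {q : Fin 13 → ℕ}

/-- Some color is primary at `9` or more vertices: otherwise there are too few edges to give each
vertex `8` edges of its primary color. -/
theorem exists_nine_le_card_class (hsymm : ∀ i j, χ i j = χ j i)
    (hχ : ∀ c, ∃ p : Fin 13 → Fin 3, ∀ i j, i ≠ j → χ i j = c → p i ≠ p j)
    (hq : ∀ v, 8 ≤ #(colorNbrs χ (q v) v (univ.erase v))) :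
    ∃ v, 9 ≤ #{u | q u = q v} := by
  by_contra! h
  choose p hp using hχ
  let I : Fin 13 → Finset (Fin 13) := fun v => {u ∈ univ.erase v | χ u v = q u}
  let K : Fin 13 → Finset (Fin 13) := fun v => {u | q u = q v}
  let R : Fin 13 → Finset (Fin 13) := fun v => {u ∈ K v | p (q v) u = p (q v) v}
  have hswap : ∑ v, #(I v) = ∑ v, #(colorNbrs χ (q v) v (univ.erase v)) := by
    have := sum_card_bipartiteAbove_eq_sum_card_bipartiteBelow
      (s := univ) (t := univ) (fun u v : Fin 13 => u ≠ v ∧ χ u v = q u)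
    simp only [bipartiteAbove, bipartiteBelow] at this
    convert this.symm using 3 <;> ext <;> simp [I, colorNbrs, eq_comm]
  have hthird : ∑ v, #(K v) ≤ 3 * ∑ v, #(R v) := by
    have hmaps : ∀ v ∈ (univ : Finset (Fin 13)), q v ∈ univ.image q :=
      fun v hv => mem_image_of_mem q hv
    rw [← sum_fiberwise_of_maps_to hmaps, ← sum_fiberwise_of_maps_to hmaps, mul_sum]
    refine sum_le_sum fun c _ => ?_
    have hcK : ∑ v with q v = c, #(K v) = #{v | q v = c} ^ 2 := by
      rw [sq]
      exact sum_const_nat fun v hv => by simp only [K, (mem_filter.1 hv).2]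
    have hcR : ∑ v with q v = c, #(R v) =
        ∑ v with q v = c, #{u ∈ ({w | q w = c} : Finset _) | p c u = p c v} :=
      sum_congr rfl fun v hv => by simp only [R, K, (mem_filter.1 hv).2]
    rw [hcK, hcR]
    exact sq_card_le_three_mul_sum_card _ (p c)
  have hlarge : 13 * 8 ≤ ∑ v, #(colorNbrs χ (q v) v (univ.erase v)) := by
    simpa using card_nsmul_le_sum univ (fun v => #(colorNbrs χ (q v) v (univ.erase v))) 8
      fun v _ => hq v
  have hK : ∑ v, #(K v) ≤ 13 * 8 := by
    simpa using sum_le_card_nsmul univ (fun v => #(K v)) 8 fun v _ => Nat.le_of_lt_succ (h v)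
  have hpoint : ∀ v, #(colorNbrs χ (q v) v (univ.erase v)) + #(I v) + 2 * #(R v) ≤
      13 + #(K v) := by
    intro v
    have hne : ∀ u ∈ colorNbrs χ (q v) v (univ.erase v), p (q v) u ≠ p (q v) v := fun u hu =>
      (hp _ v u (ne_of_mem_erase (mem_filter.1 hu).1).symm (mem_filter.1 hu).2).symm
    have hunion : #(colorNbrs χ (q v) v (univ.erase v) ∪ I v) + #(R v) ≤ 13 := by
      rw [← card_union_of_disjoint]
      · exact card_le_univ _
      · rw [disjoint_left]
        intro u hu hR
        obtain ⟨hK, hR⟩ := mem_filter.1 hR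
        rcases mem_union.1 hu with hu | hu
        · exact hne u hu hR
        · obtain ⟨huv, hu⟩ := mem_filter.1 hu
          exact hp _ u v (ne_of_mem_erase huv) (hu.trans (mem_filter.1 hK).2) hR
    have hinter : #(colorNbrs χ (q v) v (univ.erase v) ∩ I v) + #(R v) ≤ #(K v) := by
      rw [← card_union_of_disjoint]
      · refine card_le_card (union_subset (fun u hu => ?_) (filter_subset _ _))
        obtain ⟨h1, h2⟩ := mem_inter.1 hu
        refine mem_filter.2 ⟨mem_univ _, ?_⟩
        rw [← (mem_filter.1 h1).2, ← (mem_filter.1 h2).2, hsymm]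
      · exact disjoint_left.2 fun u hu hR =>
          hne u (mem_of_mem_inter_left hu) (mem_filter.1 hR).2
    have := card_union_add_card_inter (colorNbrs χ (q v) v (univ.erase v)) (I v)
    omega
  have hsmall := sum_le_sum fun v (_ : v ∈ univ) => hpoint v
  rw [sum_add_distrib, sum_add_distrib, sum_add_distrib, ← mul_sum, hswap] at hsmall
  simp at hsmall
  omega

/-- Edge count for a primary color `α`: the `8` or more `α`-edges at each vertex with primary color
`α` go to the other parts of the `α`-tripartition or to vertices of small `α`-degree. -/
theorem card_class_bound (hsymm : ∀ i j, χ i j = χ j i)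
    (hχ : ∀ c, ∃ p : Fin 13 → Fin 3, ∀ i j, i ≠ j → χ i j = c → p i ≠ p j)
    (hq : ∀ v, 8 ≤ #(colorNbrs χ (q v) v (univ.erase v))) (α : ℕ) :
    24 * #{v | q v = α} +
        3 * ∑ u with q u ≠ α, #(colorNbrs χ (q u) u (univ.erase u)) ≤
      2 * #{v | q v = α} ^ 2 + 36 * #{u | q u ≠ α} := by
  obtain ⟨p, hp⟩ := hχ α
  set A : Finset (Fin 13) := {v | q v = α} with hA
  set B : Finset (Fin 13) := {v | q v ≠ α} with hB
  have hlow : 8 * #A ≤ ∑ v ∈ A, (#{u ∈ A | ¬ p u = p v} + #{u ∈ B | χ v u = α}) := by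
    rw [mul_comm]
    refine card_nsmul_le_sum A _ 8 fun v hv => ?_
    have hvα : q v = α := (mem_filter.1 hv).2
    refine (hvα ▸ hq v).trans ((card_le_card fun u hu => ?_).trans (card_union_le _ _))
    obtain ⟨hu, huα⟩ := mem_filter.1 hu
    by_cases hqu : q u = α
    · exact mem_union_left _ (mem_filter.2 ⟨mem_filter.2 ⟨mem_univ _, hqu⟩,
        (hp v u (ne_of_mem_erase hu).symm huα).symm⟩)
    · exact mem_union_right _ (mem_filter.2 ⟨mem_filter.2 ⟨mem_univ _, hqu⟩, huα⟩)
  have hin : ∑ v ∈ A, #{u ∈ A | p u = p v} + ∑ v ∈ A, #{u ∈ A | ¬ p u = p v} = #A ^ 2 := by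
    rw [← sum_add_distrib, sq]
    exact sum_const_nat fun v _ => card_filter_add_card_filter_not _
  have hout : ∑ v ∈ A, #{u ∈ B | χ v u = α} +
      ∑ u ∈ B, #(colorNbrs χ (q u) u (univ.erase u)) ≤ #B * 12 := by
    have := sum_card_bipartiteAbove_eq_sum_card_bipartiteBelow
      (s := A) (t := B) (fun v u => χ v u = α)
    simp only [bipartiteAbove, bipartiteBelow] at this
    rw [this, ← sum_add_distrib]
    refine sum_le_card_nsmul B _ 12 fun u hu => ?_
    have huα : q u ≠ α := (mem_filter.1 hu).2
    have h1 : #{v ∈ A | χ v u = α} ≤ #(colorNbrs χ α u (univ.erase u)) := by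
      refine card_le_card fun v hv => ?_
      obtain ⟨hvA, hvu⟩ := mem_filter.1 hv
      refine mem_filter.2 ⟨mem_erase.2 ⟨?_, mem_univ _⟩, by rwa [hsymm]⟩
      rintro rfl
      exact huα (mem_filter.1 hvA).2
    have h2 := card_colorNbrs_add_le (χ := χ) (v := u) (S := univ.erase u) huα.symm
    simp at h2
    omega
  have hthird := sq_card_le_three_mul_sum_card A p
  rw [sum_add_distrib] at hlow
  omega

/-- If all vertices have a primary color and lie in many triangles of that color, then there is
only one primary color. -/
theorem exists_forall_primary_eq (hsymm : ∀ i j, χ i j = χ j i)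
    (hχ : ∀ c, ∃ p : Fin 13 → Fin 3, ∀ i j, i ≠ j → χ i j = c → p i ≠ p j)
    (hq : ∀ v, 8 ≤ #(colorNbrs χ (q v) v (univ.erase v)))
    (hlink : ∀ v, #(colorNbrs χ (q v) v (univ.erase v)) + 7 ≤
      #(colorLink χ (q v) v (univ.erase v))) :
    ∃ α, ∀ v, q v = α := by
  obtain ⟨v₀, hv₀⟩ := exists_nine_le_card_class hsymm hχ hq
  refine ⟨q v₀, ?_⟩
  generalize q v₀ = α at hv₀
  by_contra! ⟨u, hu⟩
  have hbound := card_class_bound hsymm hχ hq α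
  set B : Finset (Fin 13) := {v | q v ≠ α} with hB
  have huB : u ∈ B := by simp [hB, hu]
  have hAB : #{v | q v = α} + #B = 13 :=
    (card_filter_add_card_filter_not _).trans (by simp)
  rw [← add_sum_erase _ _ huB] at hbound
  have herase : 8 * (#B - 1) ≤ ∑ v ∈ B.erase u, #(colorNbrs χ (q v) v (univ.erase v)) := by
    rw [mul_comm, ← card_erase_of_mem huB]
    exact card_nsmul_le_sum _ _ 8 fun v _ => hq v
  have hBpos : 1 ≤ #B := card_pos.2 ⟨u, huB⟩
  have hD := hlink u
  have hdeg : ∀ w ∈ colorNbrs χ (q u) u (univ.erase u),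
      #(colorNbrs χ (q u) w ((colorNbrs χ (q u) u (univ.erase u)).erase w)) ≤
        3 + if q w = q u then #(colorNbrs χ (q u) u (univ.erase u)) - 4 else 0 := by
    intro w hw
    obtain ⟨hwu, hwc⟩ := mem_filter.1 hw
    split_ifs with hqw
    · have := card_filter_le ((colorNbrs χ (q u) u (univ.erase u)).erase w) fun x => χ w x = q u
      rw [card_erase_of_mem hw] at this
      have := hq u
      simp only [colorNbrs] at *
      omega
    · have h1 := card_colorNbrs_add_le (χ := χ) (v := w) (S := univ.erase w) hqw
      have h2 := hq w
      have h3 : #(colorNbrs χ (q u) w ((colorNbrs χ (q u) u (univ.erase u)).erase w)) + 1 ≤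
          #(colorNbrs χ (q u) w (univ.erase w)) := by
        rw [← card_insert_of_notMem (a := u)]
        · refine card_le_card fun x hx => ?_
          rcases mem_insert.1 hx with rfl | hx
          · exact mem_filter.2 ⟨mem_erase.2 ⟨(ne_of_mem_erase hwu).symm, mem_univ _⟩,
              by rwa [hsymm]⟩
          · obtain ⟨hx, hxc⟩ := mem_filter.1 hx
            exact mem_filter.2 ⟨mem_erase.2 ⟨ne_of_mem_erase hx, mem_univ _⟩, hxc⟩
        · simp [colorNbrs]
      simp at h1
      omega
  have htwo := (two_mul_card_colorLink_le (χ := χ) (c := q u) (v := u)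
    (S := univ.erase u)).trans (sum_le_sum hdeg)
  rw [sum_add_distrib, sum_const, ← sum_filter, sum_const, smul_eq_mul, smul_eq_mul] at htwo
  have hsame : #{w ∈ colorNbrs χ (q u) u (univ.erase u) | q w = q u} ≤ #B - 1 := by
    rw [← card_erase_of_mem huB]
    refine card_le_card fun w hw => ?_
    obtain ⟨hw, hqw⟩ := mem_filter.1 hw
    exact mem_erase.2 ⟨ne_of_mem_erase (mem_filter.1 hw).1, by simp [hB, hqw, hu]⟩
  have hD12 : #(colorNbrs χ (q u) u (univ.erase u)) ≤ 12 :=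
    (card_filter_le _ _).trans (by simp)
  have hD8 := hq u
  have htwo' := htwo.trans (Nat.add_le_add_left (Nat.mul_le_mul_right _ hsame) _)
  generalize #(colorNbrs χ (q u) u (univ.erase u)) = D at *
  generalize #{v | q v = α} = k at *
  obtain rfl | hB2 | hB3 : k = 12 ∨ k = 11 ∨ k ≤ 10 := by omega
  · have : #B = 1 := by omega
    rw [this] at htwo'
    omega
  · subst hB2
    have : #B = 2 := by omega
    rw [this] at htwo' hbound herase
    omega
  · interval_cases k <;> omega

end

theorem card_monoTrianglesIn_erase_le
    (h12 : ∀ χ : Fin 12 → Fin 12 → ℕ, IsTripartiteColoring 12 χ →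
      (monoTriangles 12 χ).ncard ≤ 70)
    {χ : Fin 13 → Fin 13 → ℕ} (hχ : IsTripartiteColoring 13 χ) (v : Fin 13) :
    #(monoTrianglesIn χ (univ.erase v)) ≤ 70 := by
  classical
  let f : Fin 12 ↪ Fin 13 := v.succAboveEmb
  have hχ' : IsTripartiteColoring 12 fun i j => χ (f i) (f j) :=
    ⟨fun i j => hχ.1 _ _, fun c => by
      obtain ⟨p, hp⟩ := hχ.2 c
      exact ⟨p ∘ f, fun i j hij => hp _ _ (f.injective.ne hij)⟩⟩
  refine le_trans ?_ (h12 _ hχ')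
  have hsub : (monoTrianglesIn χ (univ.erase v) : Set (Finset (Fin 13))) ⊆
      (fun s => s.map f) '' monoTriangles 12 fun i j => χ (f i) (f j) := by
    intro s hs
    obtain ⟨hs, c, hc⟩ := mem_filter.1 (mem_coe.1 hs)
    obtain ⟨hsv, hs3⟩ := mem_powersetCard.1 hs
    have hlift : ∀ x ∈ s, ∃ i, f i = x := fun x hx =>
      Fin.exists_succAbove_eq (ne_of_mem_erase (hsv hx))
    obtain ⟨x, y, z, hxy, hxz, hyz, rfl⟩ := card_eq_three.1 hs3
    obtain ⟨i, rfl⟩ := hlift x (by simp)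
    obtain ⟨j, rfl⟩ := hlift y (by simp)
    obtain ⟨k, rfl⟩ := hlift z (by simp)
    refine ⟨{i, j, k}, ⟨i, j, k, fun h => hxy (h ▸ rfl), fun h => hxz (h ▸ rfl),
      fun h => hyz (h ▸ rfl), rfl, ?_, ?_⟩, by simp [map_insert]⟩
    · exact (hc _ (by simp) _ (by simp) hxy).trans (hc _ (by simp) _ (by simp) hyz).symm
    · exact (hc _ (by simp) _ (by simp) hyz).trans (hc _ (by simp) _ (by simp) hxz).symm
  rw [← Set.ncard_coe_finset]
  exact (Set.ncard_le_ncard hsub (Set.toFinite _)).trans (Set.ncard_image_le (Set.toFinite _))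

theorem ncard_monoTriangles_le {n : ℕ} {χ : Fin n → Fin n → ℕ} (hsymm : ∀ i j, χ i j = χ j i) :
    (monoTriangles n χ).ncard ≤ #(monoTrianglesIn χ univ) := by
  classical
  rw [← Set.ncard_coe_finset]
  refine Set.ncard_le_ncard ?_ (Set.toFinite _)
  rintro s ⟨x, y, z, hxy, hxz, hyz, rfl, h1, h2⟩
  refine mem_coe.2 (mem_filter.2 ⟨mem_powersetCard.2 ⟨subset_univ _,
    card_eq_three.2 ⟨x, y, z, hxy, hxz, hyz, rfl⟩⟩, χ x y, ?_⟩)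
  intro a ha b hb hab
  simp only [mem_insert, mem_singleton] at ha hb
  rcases ha with rfl | rfl | rfl <;> rcases hb with rfl | rfl | rfl <;>
    simp_all

/-- Given that every tripartite coloring of `K_12` has at most `g₃(12) = 70` monochromatic
triangles, every tripartite coloring of `K_13` has at most `g₃(13) = 88`. -/
theorem stmt_16
    (h12 : ∀ χ : Fin 12 → Fin 12 → ℕ, IsTripartiteColoring 12 χ →
      (monoTriangles 12 χ).ncard ≤ 70)
    (χ : Fin 13 → Fin 13 → ℕ) (hχ : IsTripartiteColoring 13 χ) :
    (monoTriangles 13 χ).ncard ≤ 88 := by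
  refine (ncard_monoTriangles_le hχ.1).trans ?_
  by_contra! hmany
  have ht : ∀ v, 19 ≤ ∑ c ∈ (univ.erase v).image (χ v), #(colorLink χ c v (univ.erase v)) := by
    intro v
    have h1 := card_monoTrianglesIn_insert_le (χ := χ) v (univ.erase v)
    rw [insert_erase (mem_univ v)] at h1
    have h2 := card_monoTrianglesIn_erase_le h12 hχ v
    omega
  have hcard : ∀ v : Fin 13, #(univ.erase v) = 12 := fun v => by simp
  choose q hq hq8 using fun v =>
    exists_eight_le_card_colorNbrs (notMem_erase v univ) (hcard v) hχ.2 (ht v)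
  obtain ⟨α, hα⟩ := exists_forall_primary_eq hχ.1 hχ.2 hq8 fun v =>
    card_colorNbrs_add_seven_le (notMem_erase v univ) (hcard v) hχ.2 (ht v) (hq v) (hq8 v)
  have := card_monoTrianglesIn_le_of_forall_eight_le hχ.1 hχ.2 fun v => hα v ▸ hq8 v
  omega
end
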